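/- (Combined deviation bound, eq. (9)) Let W ~ N(0, σ²I_n) and let Z₁,…,Z_R be i.i.d. N(0, I_n) random vectors independent of W. Then for every q ∈ [1,∞] and every t₁, t₂ ≥ 0, P{ ‖(1/n)XᵀW‖_q ≥ (σ/R) ∑_{r=1}^R ‖(1/n)XᵀZ_r‖_q + t₁ + t₂ } ≤ exp( −n t₁² / (2σ² N_q(X)²) ) + exp( −nR t₂² / (2σ² N_q(X)²) ). -/

import Mathlib

open MeasureTheory ProbabilityTheory
open scoped ENNReal NNReal

noncomputable def lqNorm (q : ℝ≥0∞) {L : ℕ} (v : Fin L → ℝ) : ℝ :=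
  (eLpNorm v q Measure.count).toReal

noncomputable def Nq (q : ℝ≥0∞) {n L : ℕ} (X : Fin n → Fin L → ℝ) : ℝ :=
  lqNorm q (fun j => Real.sqrt ((1 / (n : ℝ)) * ∑ i, (X i j) ^ 2))

noncomputable def gaussianVec (n : ℕ) (σ : ℝ) : Measure (Fin n → ℝ) :=
  Measure.pi (fun _ => gaussianReal 0 ⟨σ ^ 2, sq_nonneg σ⟩)

section PL
open scoped Pointwise

theorem vol_affine (c d : ℝ) (hc : 0 < c) (K : Set ℝ) :
    volume ((fun x => c * x + d) '' K) = ENNReal.ofReal c * volume K := by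
  have : (fun x => c * x + d) '' K = (fun x => x + d) '' (c • K) := by
    ext y; simp [Set.mem_smul_set, ← sub_eq_add_neg, eq_sub_iff_add_eq]
  rw [this, Set.image_add_right, measure_preimage_add_right, Measure.addHaar_smul]
  simp [abs_of_pos hc]

theorem bm_compact {s : ℝ} (hs0 : 0 < s) (hs1 : s < 1) {A B C : Set ℝ}
    (hA : IsCompact A) (hB : IsCompact B) (hAn : A.Nonempty) (hBn : B.Nonempty)
    (h : ∀ x ∈ A, ∀ y ∈ B, (1 - s) * x + s * y ∈ C) :
    ENNReal.ofReal (1 - s) * volume A + ENNReal.ofReal s * volume B ≤ volume C := by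
  obtain ⟨x0, hx0, hx⟩ := hA.exists_isGreatest hAn
  obtain ⟨y0, hy0, hy⟩ := hB.exists_isLeast hBn
  rw [← vol_affine (1 - s) (s * y0) (by linarith) A, ← vol_affine s ((1 - s) * x0) hs0 B]
  have hm : MeasurableSet ((fun x => s * x + (1 - s) * x0) '' B) :=
    (hB.image (by fun_prop)).measurableSet
  rw [← measure_union₀ hm.nullMeasurableSet]
  · apply measure_mono
    rintro _ (⟨x, hxA, rfl⟩ | ⟨y, hyB, rfl⟩)
    · exact h x hxA y0 hy0
    · have := h x0 hx0 y hyB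
      simpa [add_comm] using this
  · refine measure_mono_null (t := {(1 - s) * x0 + s * y0}) ?_ (by simp)
    rintro z ⟨⟨x, hxA, rfl⟩, ⟨y, hyB, hxy⟩⟩
    have h1 := hx hxA
    have h2 := hy hyB
    simp only [Set.mem_singleton_iff] at *
    nlinarith [mul_le_mul_of_nonneg_left h1 (by linarith : (0:ℝ) ≤ 1 - s), mul_le_mul_of_nonneg_left h2 hs0.le]

theorem bm1 {s : ℝ} (hs0 : 0 < s) (hs1 : s < 1) {A B C : Set ℝ}
    (hA : MeasurableSet A) (hB : MeasurableSet B) (hAn : A.Nonempty) (hBn : B.Nonempty)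
    (h : ∀ x ∈ A, ∀ y ∈ B, (1 - s) * x + s * y ∈ C) :
    ENNReal.ofReal (1 - s) * volume A + ENNReal.ofReal s * volume B ≤ volume C := by
  obtain ⟨x0, hx0⟩ := hAn
  obtain ⟨y0, hy0⟩ := hBn
  rw [hA.measure_eq_iSup_isCompact, hB.measure_eq_iSup_isCompact]
  simp only [ENNReal.mul_iSup, iSup_and']
  refine ENNReal.biSup_add_biSup_le' ⟨∅, by simp⟩ ⟨∅, by simp⟩ ?_
  rintro K ⟨hK, hKc⟩ K' ⟨hK', hKc'⟩
  refine le_trans ?_ (bm_compact hs0 hs1 (hKc.insert x0) (hKc'.insert y0) (by simp) (by simp) (C := C) ?_)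
  · gcongr <;> exact Set.subset_insert _ _
  · intro x hx y hy
    refine h x ?_ y ?_
    · rcases hx with rfl | hx
      exacts [hx0, hK hx]
    · rcases hy with rfl | hy
      exacts [hy0, hK' hy]

theorem pl_norm {s : ℝ} (hs0 : 0 < s) (hs1 : s < 1) {a b h : ℝ → ℝ≥0∞}
    (ha : Measurable a) (hb : Measurable b) (hh : Measurable h)
    (ha1 : ⨆ x, a x = 1) (hb1 : ⨆ x, b x = 1)
    (H : ∀ x y, a x ^ (1 - s) * b y ^ s ≤ h ((1 - s) * x + s * y)) :
    ENNReal.ofReal (1 - s) * (∫⁻ x, a x) + ENNReal.ofReal s * (∫⁻ x, b x) ≤ ∫⁻ x, h x := by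
  have key : ∀ f : ℝ → ℝ≥0∞, Measurable f → (∀ x, f x ≤ 1) →
      ∫⁻ x, f x = ∫⁻ t in Set.Ioi (0:ℝ), volume {x | ENNReal.ofReal t < f x} := by
    intro f hf hf1
    have hlt : ∀ x, f x ≠ ⊤ := fun x => ne_top_of_le_ne_top ENNReal.one_ne_top (hf1 x)
    have := lintegral_eq_lintegral_meas_lt (volume : Measure ℝ) (f := fun x => (f x).toReal)
      (Filter.Eventually.of_forall fun x => ENNReal.toReal_nonneg) hf.ennreal_toReal.aemeasurable
    simp only [ENNReal.ofReal_toReal (hlt _)] at this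
    rw [this]
    refine setLIntegral_congr_fun measurableSet_Ioi ?_
    intro t ht
    simp only
    congr 1
    ext x
    exact (ENNReal.ofReal_lt_iff_lt_toReal (le_of_lt ht) (hlt x)).symm
  have hale : ∀ x, a x ≤ 1 := fun x => ha1 ▸ le_iSup a x
  have hble : ∀ x, b x ≤ 1 := fun x => hb1 ▸ le_iSup b x
  have hmin : ∫⁻ x, min (h x) 1 ≤ ∫⁻ x, h x := lintegral_mono fun x => min_le_left _ _
  refine le_trans ?_ hmin
  rw [key a ha hale, key b hb hble, key _ (hh.min measurable_const) (fun x => min_le_right _ _)]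
  have hmeas : ∀ f : ℝ → ℝ≥0∞, Measurable (fun t : ℝ => volume {x | ENNReal.ofReal t < f x}) := by
    intro f
    apply Antitone.measurable
    intro t t' htt
    exact measure_mono fun x hx => lt_of_le_of_lt (ENNReal.ofReal_le_ofReal htt) hx
  rw [← lintegral_const_mul _ (hmeas a), ← lintegral_const_mul _ (hmeas b),
    ← lintegral_add_left ((hmeas a).const_mul _)]
  refine setLIntegral_mono' measurableSet_Ioi ?_
  intro t ht
  by_cases ht1 : t < 1
  · have h1 : ENNReal.ofReal t < 1 := by simpa using ht1
    refine bm1 hs0 hs1 (measurableSet_lt measurable_const ha) (measurableSet_lt measurable_const hb)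
      ?_ ?_ ?_
    · exact lt_iSup_iff.1 (ha1.symm ▸ h1)
    · exact lt_iSup_iff.1 (hb1.symm ▸ h1)
    · intro x hx y hy
      simp only [Set.mem_ofPred_eq] at hx hy ⊢
      refine lt_min (lt_of_lt_of_le ?_ (H x y)) h1
      have e : ENNReal.ofReal t = ENNReal.ofReal t ^ (1 - s) * ENNReal.ofReal t ^ s := by
        rw [← ENNReal.rpow_add _ _ (by simpa using ht) (by simp)]; simp
      rw [e]
      exact ENNReal.mul_lt_mul (ENNReal.rpow_lt_rpow hx (by linarith)) (ENNReal.rpow_lt_rpow hy hs0)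
  · have h1 : (1:ℝ≥0∞) ≤ ENNReal.ofReal t := by simpa using ht1
    have e1 : {x | ENNReal.ofReal t < a x} = ∅ := by
      ext x; simpa using (hale x).trans h1
    have e2 : {x | ENNReal.ofReal t < b x} = ∅ := by
      ext x; simpa using (hble x).trans h1
    simp [e1, e2]

theorem amgm {s : ℝ} (hs0 : 0 < s) (hs1 : s < 1) (A B : ℝ≥0∞) :
    A ^ (1 - s) * B ^ s ≤ ENNReal.ofReal (1 - s) * A + ENNReal.ofReal s * B := by
  have hs' : 0 < 1 - s := by linarith
  by_cases hA : A = ⊤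
  · subst hA; rw [ENNReal.mul_top (by simpa using hs1)]; simp
  by_cases hB : B = ⊤
  · subst hB; rw [ENNReal.mul_top (by simpa using hs0)]; simp
  lift A to ℝ≥0 using hA
  lift B to ℝ≥0 using hB
  have := NNReal.geom_mean_le_arith_mean2_weighted (1 - s).toNNReal s.toNNReal A B
    (by rw [← Real.toNNReal_add hs'.le hs0.le]; simp)
  rw [Real.coe_toNNReal _ hs'.le, Real.coe_toNNReal _ hs0.le] at this
  rw [← ENNReal.coe_rpow_of_nonneg _ hs'.le, ← ENNReal.coe_rpow_of_nonneg _ hs0.le]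
  rw [ENNReal.ofReal, ENNReal.ofReal]
  exact_mod_cast this

theorem pl_bdd {s : ℝ} (hs0 : 0 < s) (hs1 : s < 1) {a b h : ℝ → ℝ≥0∞}
    (ha : Measurable a) (hb : Measurable b) (hh : Measurable h)
    (ha1 : ⨆ x, a x ≠ ⊤) (hb1 : ⨆ x, b x ≠ ⊤)
    (H : ∀ x y, a x ^ (1 - s) * b y ^ s ≤ h ((1 - s) * x + s * y)) :
    (∫⁻ x, a x) ^ (1 - s) * (∫⁻ x, b x) ^ s ≤ ∫⁻ x, h x := by
  have hs' : 0 < 1 - s := by linarith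
  by_cases ha0 : ⨆ x, a x = 0
  · have : ∀ x, a x = 0 := by simpa using ha0
    simp [this, hs']
  by_cases hb0 : ⨆ x, b x = 0
  · have : ∀ x, b x = 0 := by simpa using hb0
    simp [this, hs0]
  set α := ⨆ x, a x with hα
  set β := ⨆ x, b x with hβ
  have hai : α⁻¹ ≠ ⊤ := by simpa using ha0
  have hbi : β⁻¹ ≠ ⊤ := by simpa using hb0
  have := pl_norm hs0 hs1 (a := fun x => α⁻¹ * a x) (b := fun x => β⁻¹ * b x)
    (h := fun x => ((α⁻¹) ^ (1 - s) * (β⁻¹) ^ s) * h x) (ha.const_mul _) (hb.const_mul _)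
    (hh.const_mul _) (by rw [← ENNReal.mul_iSup, ← hα, ENNReal.inv_mul_cancel ha0 ha1])
    (by rw [← ENNReal.mul_iSup, ← hβ, ENNReal.inv_mul_cancel hb0 hb1])
    (by
      intro x y
      rw [ENNReal.mul_rpow_of_nonneg _ _ hs'.le, ENNReal.mul_rpow_of_nonneg _ _ hs0.le, mul_mul_mul_comm]
      gcongr
      exact H x y)
  rw [lintegral_const_mul _ ha, lintegral_const_mul _ hb, lintegral_const_mul _ hh] at this
  have h2 := (amgm hs0 hs1 _ _).trans this
  rw [ENNReal.mul_rpow_of_nonneg _ _ hs'.le, ENNReal.mul_rpow_of_nonneg _ _ hs0.le, mul_mul_mul_comm] at h2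
  refine (ENNReal.mul_le_mul_iff_right ?_ ?_).1 h2
  · have h3 : α⁻¹ ≠ 0 := by simpa using ha1
    have h4 : β⁻¹ ≠ 0 := by simpa using hb1
    simp [ENNReal.rpow_eq_zero_iff, h3, h4, hai, hbi]
  · exact ENNReal.mul_ne_top (ENNReal.rpow_ne_top_of_nonneg hs'.le hai)
      (ENNReal.rpow_ne_top_of_nonneg hs0.le hbi)

theorem lint_trunc {f : ℝ → ℝ≥0∞} (hf : Measurable f) :
    ∫⁻ x, f x = ⨆ N : ℕ, ∫⁻ x, min (f x) N := by
  rw [← lintegral_iSup (fun N => hf.min measurable_const)]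
  · congr 1
    ext x
    rw [← inf_iSup_eq]
    simp [ENNReal.iSup_natCast]
  · intro i j hij x
    simp only
    gcongr

theorem pl1 {s : ℝ} (hs0 : 0 < s) (hs1 : s < 1) {a b h : ℝ → ℝ≥0∞}
    (ha : Measurable a) (hb : Measurable b) (hh : Measurable h)
    (H : ∀ x y, a x ^ (1 - s) * b y ^ s ≤ h ((1 - s) * x + s * y)) :
    (∫⁻ x, a x) ^ (1 - s) * (∫⁻ x, b x) ^ s ≤ ∫⁻ x, h x := by
  have hs' : 0 < 1 - s := by linarith
  rw [lint_trunc ha, lint_trunc hb]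
  have e1 := (ENNReal.orderIsoRpow (1 - s) hs').map_iSup (fun N : ℕ => ∫⁻ x, min (a x) N)
  have e2 := (ENNReal.orderIsoRpow s hs0).map_iSup (fun N : ℕ => ∫⁻ x, min (b x) N)
  simp only [ENNReal.orderIsoRpow_apply] at e1 e2
  rw [e1, e2, ENNReal.iSup_mul]
  refine iSup_le fun N => ?_
  rw [ENNReal.mul_iSup]
  refine iSup_le fun M => ?_
  refine pl_bdd hs0 hs1 (ha.min measurable_const) (hb.min measurable_const) hh ?_ ?_ ?_
  · exact ne_top_of_le_ne_top (ENNReal.natCast_ne_top N) (iSup_le fun x => min_le_right _ _)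
  · exact ne_top_of_le_ne_top (ENNReal.natCast_ne_top M) (iSup_le fun x => min_le_right _ _)
  · intro x y
    refine le_trans ?_ (H x y)
    gcongr <;> exact min_le_left _ _

end PL

def PLG (s : ℝ) {E : Type*} [MeasurableSpace E] (μ : Measure E) (c : E → E → ℝ) : Prop :=
  ∀ (K : ℝ≥0∞) (a b : E → ℝ≥0∞), Measurable a → Measurable b →
    (∀ x y, a x ^ (1 - s) * b y ^ s ≤ K * ENNReal.ofReal (Real.exp (s * (1 - s) * c x y))) →
    (∫⁻ x, a x ∂μ) ^ (1 - s) * (∫⁻ x, b x ∂μ) ^ s ≤ K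

theorem PLG.prod {s : ℝ} {E E' : Type*} [MeasurableSpace E] [MeasurableSpace E']
    {μ : Measure E} {ν : Measure E'} [SFinite μ] [SFinite ν] {c : E → E → ℝ} {d : E' → E' → ℝ}
    (h1 : PLG s μ c) (h2 : PLG s ν d) :
    PLG s (μ.prod ν) (fun x y => c x.1 y.1 + d x.2 y.2) := by
  intro K a b ha hb H
  rw [lintegral_prod _ ha.aemeasurable, lintegral_prod _ hb.aemeasurable]
  refine h1 K _ _ ha.lintegral_prod_right' hb.lintegral_prod_right' ?_
  intro x y
  refine h2 _ _ _ (ha.comp measurable_prodMk_left) (hb.comp measurable_prodMk_left) ?_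
  intro x' y'
  refine (H (x, x') (y, y')).trans_eq ?_
  rw [mul_assoc K, ← ENNReal.ofReal_mul (Real.exp_pos _).le, ← Real.exp_add]
  simp only [mul_add]

theorem PLG.pi {s : ℝ} {E : Type*} [MeasurableSpace E]
    {μ : Measure E} [IsProbabilityMeasure μ] {c : E → E → ℝ}
    (h : PLG s μ c) (k : ℕ) :
    PLG s (Measure.pi (fun _ : Fin k => μ)) (fun x y => ∑ i, c (x i) (y i)) := by
  induction k with
  | zero =>
    intro K a b ha hb H
    rw [Measure.pi_of_empty _ (fun i => i.elim0), lintegral_dirac' _ ha, lintegral_dirac' _ hb]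
    simpa using H (fun i => i.elim0) (fun i => i.elim0)
  | succ k ih =>
    intro K a b ha hb H
    have mp := (measurePreserving_piFinSuccAbove (fun _ : Fin (k + 1) => μ) 0).symm
    rw [← mp.lintegral_comp ha, ← mp.lintegral_comp hb]
    refine (h.prod ih) K _ _ (ha.comp mp.measurable) (hb.comp mp.measurable) ?_
    intro x y
    refine (H _ _).trans_eq ?_
    simp [Fin.sum_univ_succ, MeasurableEquiv.piFinSuccAbove]

theorem PLG.gauss {s : ℝ} (hs0 : 0 < s) (hs1 : s < 1) {v : ℝ≥0} (hv : v ≠ 0) :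
    PLG s (gaussianReal 0 v) (fun x y => (x - y) ^ 2 / (2 * v)) := by
  intro K a b ha hb H
  have hs' : 0 < 1 - s := by linarith
  have hp := measurable_gaussianPDF 0 v
  rw [gaussianReal_of_var_ne_zero _ hv, lintegral_withDensity_eq_lintegral_mul _ hp ha,
    lintegral_withDensity_eq_lintegral_mul _ hp hb]
  have := pl1 hs0 hs1 (hp.mul ha) (hp.mul hb) (h := fun x => K * gaussianPDF 0 v x)
    (hp.const_mul K) ?_
  · rwa [lintegral_const_mul _ hp, lintegral_gaussianPDF_eq_one _ hv, mul_one] at this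
  intro x y
  simp only [Pi.mul_apply]
  rw [ENNReal.mul_rpow_of_nonneg _ _ hs'.le, ENNReal.mul_rpow_of_nonneg _ _ hs0.le, mul_mul_mul_comm]
  refine (mul_le_mul_right (H x y) _).trans_eq ?_
  rw [mul_left_comm]
  congr 1
  have hv' : (0:ℝ) < v := by positivity
  have hC : (0:ℝ) < (√(2 * Real.pi * v))⁻¹ := by positivity
  simp only [gaussianPDF, gaussianPDFReal]
  rw [ENNReal.ofReal_rpow_of_pos (by positivity), ENNReal.ofReal_rpow_of_pos (by positivity),
    ← ENNReal.ofReal_mul (by positivity), ← ENNReal.ofReal_mul (by positivity)]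
  congr 1
  generalize (√(2 * Real.pi * v))⁻¹ = C at hC
  rw [Real.mul_rpow hC.le (Real.exp_pos _).le, Real.mul_rpow hC.le (Real.exp_pos _).le,
    mul_mul_mul_comm, ← Real.rpow_add hC, ← Real.exp_mul, ← Real.exp_mul, ← Real.exp_add,
    mul_assoc, ← Real.exp_add]
  simp only [sub_add_cancel, Real.rpow_one]
  congr 2
  field_simp
  ring

theorem ofReal_int_le {E : Type*} [MeasurableSpace E] {μ : Measure E} {f : E → ℝ}
    (hf : Integrable f μ) : ENNReal.ofReal (∫ x, f x ∂μ) ≤ ∫⁻ x, ENNReal.ofReal (f x) ∂μ := by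
  have h1 : ∫ x, f x ∂μ ≤ ∫ x, max (f x) 0 ∂μ :=
    integral_mono hf hf.pos_part (fun x => le_max_left _ _)
  refine (ENNReal.ofReal_le_ofReal h1).trans ?_
  rw [ofReal_integral_eq_lintegral_ofReal hf.pos_part
    (Filter.Eventually.of_forall fun x => le_max_right _ _)]
  refine lintegral_mono fun x => ?_
  simp [ENNReal.ofReal_max]

theorem conc_s {s : ℝ} (hs0 : 0 < s) (hs1 : s < 1) {E : Type*} [MeasurableSpace E] {μ : Measure E}
    [IsProbabilityMeasure μ] {c : E → E → ℝ}
    (h : PLG s μ c) {G : E → ℝ} (hG : Measurable G) (hGi : Integrable G μ) (hG0 : ∫ x, G x ∂μ = 0)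
    {V : ℝ} (hV : 0 < V)
    (hc : ∀ θ : ℝ, 0 ≤ θ → ∀ x y, θ * (G x - G y) ≤ θ ^ 2 * V / 2 + c x y) {t : ℝ} (ht : 0 ≤ t) :
    (μ {x | t ≤ G x}).toReal ≤ Real.exp (s * (-t ^ 2 / (2 * V))) := by
  have hs' : 0 < 1 - s := by linarith
  set θ := t / V with hθ
  have hθ0 : 0 ≤ θ := by positivity
  have key := h (ENNReal.ofReal (Real.exp (s * (1 - s) * (θ ^ 2 * V / 2))))
    (fun x => ENNReal.ofReal (Real.exp (s * θ * G x)))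
    (fun x => ENNReal.ofReal (Real.exp (-((1 - s) * θ) * G x))) (by fun_prop) (by fun_prop) (by
      intro x y
      rw [ENNReal.ofReal_rpow_of_pos (Real.exp_pos _), ENNReal.ofReal_rpow_of_pos (Real.exp_pos _),
        ← ENNReal.ofReal_mul (by positivity), ← ENNReal.ofReal_mul (by positivity),
        ← Real.exp_mul, ← Real.exp_mul, ← Real.exp_add, ← Real.exp_add]
      apply ENNReal.ofReal_le_ofReal
      apply Real.exp_le_exp.2
      have := mul_le_mul_of_nonneg_left (hc θ hθ0 x y) (by positivity : 0 ≤ s * (1 - s))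
      linarith)
  have hB : 1 ≤ ∫⁻ x, ENNReal.ofReal (Real.exp (-((1 - s) * θ) * G x)) ∂μ := by
    have hi : Integrable (fun x => 1 + (-((1 - s) * θ)) * G x) μ :=
      (integrable_const _).add (hGi.const_mul _)
    have h1 := ofReal_int_le hi
    rw [integral_add (integrable_const _) (hGi.const_mul _), integral_const_mul, hG0] at h1
    simp only [integral_const, probReal_univ, smul_eq_mul, mul_one, mul_zero, add_zero,
      ENNReal.ofReal_one] at h1
    refine h1.trans (lintegral_mono fun x => ENNReal.ofReal_le_ofReal ?_)
    have := Real.add_one_le_exp (-((1 - s) * θ) * G x)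
    linarith
  have hA : (∫⁻ x, ENNReal.ofReal (Real.exp (s * θ * G x)) ∂μ) ≤
      ENNReal.ofReal (Real.exp (s * (θ ^ 2 * V / 2))) := by
    rw [← ENNReal.rpow_le_rpow_iff hs', ENNReal.ofReal_rpow_of_pos (Real.exp_pos _), ← Real.exp_mul]
    refine le_trans ?_ (key.trans_eq ?_)
    · refine le_mul_of_one_le_right (by simp) ?_
      exact ENNReal.one_le_rpow hB hs0
    · ring_nf
  have hm := mul_meas_ge_le_lintegral₀ (μ := μ) (f := fun x => ENNReal.ofReal (Real.exp (s * θ * G x)))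
    (by fun_prop) (ENNReal.ofReal (Real.exp (s * θ * t)))
  have hsub : μ {x | t ≤ G x} ≤
      μ {x | ENNReal.ofReal (Real.exp (s * θ * t)) ≤ ENNReal.ofReal (Real.exp (s * θ * G x))} := by
    refine measure_mono fun x hx => ?_
    refine ENNReal.ofReal_le_ofReal (Real.exp_le_exp.2 ?_)
    exact mul_le_mul_of_nonneg_left hx (by positivity)
  have h3 : ENNReal.ofReal (Real.exp (s * θ * t)) * μ {x | t ≤ G x} ≤
      ENNReal.ofReal (Real.exp (s * (θ ^ 2 * V / 2))) :=
    ((mul_le_mul_right hsub _).trans hm).trans hA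
  have h4 := ENNReal.toReal_mono ENNReal.ofReal_ne_top h3
  rw [ENNReal.toReal_mul, ENNReal.toReal_ofReal (Real.exp_pos _).le,
    ENNReal.toReal_ofReal (Real.exp_pos _).le] at h4
  have h5 : Real.exp (s * (-t ^ 2 / (2 * V))) =
      Real.exp (s * (θ ^ 2 * V / 2)) / Real.exp (s * θ * t) := by
    rw [← Real.exp_sub, hθ]
    congr 1
    field_simp
    ring
  rw [h5, le_div_iff₀ (Real.exp_pos _), mul_comm]
  exact h4

theorem conc {E : Type*} [MeasurableSpace E] {μ : Measure E}
    [IsProbabilityMeasure μ] {c : E → E → ℝ}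
    (h : ∀ s : ℝ, 0 < s → s < 1 → PLG s μ c)
    {G : E → ℝ} (hG : Measurable G) (hGi : Integrable G μ) (hG0 : ∫ x, G x ∂μ = 0)
    {V : ℝ} (hV : 0 < V)
    (hc : ∀ θ : ℝ, 0 ≤ θ → ∀ x y, θ * (G x - G y) ≤ θ ^ 2 * V / 2 + c x y) {t : ℝ} (ht : 0 ≤ t) :
    (μ {x | t ≤ G x}).toReal ≤ Real.exp (-t ^ 2 / (2 * V)) := by
  have hcont : Continuous (fun s : ℝ => Real.exp (s * (-t ^ 2 / (2 * V)))) := by fun_prop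
  have ht1 := (hcont.tendsto 1).mono_left (nhdsWithin_le_nhds (s := Set.Iio 1))
  rw [one_mul] at ht1
  refine ge_of_tendsto ht1 ?_
  filter_upwards [Ioo_mem_nhdsLT (zero_lt_one' ℝ)] with s hs
  exact conc_s hs.1 hs.2 (h s hs.1 hs.2) hG hGi hG0 hV hc ht

theorem lq_ne_top (q : ℝ≥0∞) {L : ℕ} (v : Fin L → ℝ) : eLpNorm v q Measure.count ≠ ⊤ :=
  (MemLp.of_discrete (f := v) (p := q) (μ := Measure.count)).eLpNorm_ne_top

theorem lq_add (q : ℝ≥0∞) (hq : 1 ≤ q) {L : ℕ} (u v : Fin L → ℝ) :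
    lqNorm q (u + v) ≤ lqNorm q u + lqNorm q v := by
  unfold lqNorm
  rw [← ENNReal.toReal_add (lq_ne_top q u) (lq_ne_top q v)]
  exact ENNReal.toReal_mono (ENNReal.add_ne_top.2 ⟨lq_ne_top q u, lq_ne_top q v⟩)
    (eLpNorm_add_le .of_discrete .of_discrete hq)

theorem lq_mono (q : ℝ≥0∞) {L : ℕ} (u v : Fin L → ℝ) (h : ∀ j, |u j| ≤ v j) :
    lqNorm q u ≤ lqNorm q v :=
  ENNReal.toReal_mono (lq_ne_top q v) (eLpNorm_mono_real h)

theorem lq_smul (q : ℝ≥0∞) {L : ℕ} (c : ℝ) (hc : 0 ≤ c) (v : Fin L → ℝ) :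
    lqNorm q (c • v) = c * lqNorm q v := by
  unfold lqNorm
  rw [eLpNorm_const_smul, ENNReal.toReal_mul]
  simp [abs_of_nonneg hc]

noncomputable def FF (q : ℝ≥0∞) {n L : ℕ} (X : Fin n → Fin L → ℝ) (w : Fin n → ℝ) : ℝ :=
  lqNorm q (fun j => (1 / (n : ℝ)) * ∑ i, X i j * w i)

theorem FF_smul (q : ℝ≥0∞) {n L : ℕ} (X : Fin n → Fin L → ℝ) (c : ℝ) (hc : 0 ≤ c) (w : Fin n → ℝ) :
    FF q X (fun i => c * w i) = c * FF q X w := by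
  unfold FF
  rw [← lq_smul _ _ hc]
  congr 1
  ext j
  simp only [Pi.smul_apply, smul_eq_mul, Finset.mul_sum]
  exact Finset.sum_congr rfl fun i _ => by ring

theorem FF_le (q : ℝ≥0∞) {n L : ℕ} (hn : 1 ≤ n) (X : Fin n → Fin L → ℝ) (w : Fin n → ℝ) :
    FF q X w ≤ Nq q X / √n * √(∑ i, w i ^ 2) := by
  have hn' : (0:ℝ) < n := by exact_mod_cast hn
  have : Nq q X / √n * √(∑ i, w i ^ 2) = (√(∑ i, w i ^ 2) / √n) * Nq q X := by ring
  rw [this, Nq, ← lq_smul _ _ (by positivity)]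
  apply lq_mono
  intro j
  simp only [Pi.smul_apply, smul_eq_mul]
  have h1 : |∑ i, X i j * w i| ≤ √(∑ i, X i j ^ 2) * √(∑ i, w i ^ 2) := by
    rw [← Real.sqrt_mul (by positivity)]
    exact Real.abs_le_sqrt (Finset.sum_mul_sq_le_sq_mul_sq _ _ _)
  rw [abs_mul, abs_of_pos (by positivity), Real.sqrt_mul (by positivity), Real.sqrt_div (by simp),
    Real.sqrt_one]
  have h2 : √(∑ i, w i ^ 2) / √n * (1 / √n * √(∑ i, X i j ^ 2)) =
      1 / n * (√(∑ i, X i j ^ 2) * √(∑ i, w i ^ 2)) := by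
    have := Real.mul_self_sqrt hn'.le
    have h0 : √(n:ℝ) ≠ 0 := by positivity
    nth_rewrite 3 [← this]
    field_simp
  rw [h2]
  gcongr

theorem FF_lip (q : ℝ≥0∞) (hq : 1 ≤ q) {n L : ℕ} (hn : 1 ≤ n) (X : Fin n → Fin L → ℝ) (w w' : Fin n → ℝ) :
    FF q X w - FF q X w' ≤ Nq q X / √n * √(∑ i, (w i - w' i) ^ 2) := by
  have h := FF_le q hn X (w - w')
  have h2 : FF q X w ≤ FF q X w' + FF q X (w - w') := by
    refine le_trans (le_of_eq ?_) (lq_add q hq _ _)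
    unfold FF
    congr 1
    ext j
    simp only [Pi.add_apply, Pi.sub_apply, ← mul_add, ← Finset.sum_add_distrib]
    congr 1
    exact Finset.sum_congr rfl fun i _ => by ring
  simp only [Pi.sub_apply] at h
  linarith

theorem FF_cont (q : ℝ≥0∞) (hq : 1 ≤ q) {n L : ℕ} (hn : 1 ≤ n) (X : Fin n → Fin L → ℝ) :
    Continuous (FF q X) := by
  rw [continuous_iff_continuousAt]
  intro w
  have hc : Continuous (fun w' : Fin n → ℝ => Nq q X / √n * √(∑ i, (w' i - w i) ^ 2)) := by fun_prop
  have h0 := hc.tendsto w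
  simp only [sub_self, ne_eq, OfNat.ofNat_ne_zero, not_false_eq_true, zero_pow,
    Finset.sum_const_zero, Real.sqrt_zero, mul_zero] at h0
  rw [ContinuousAt, tendsto_iff_dist_tendsto_zero]
  refine squeeze_zero (fun _ => dist_nonneg) (fun w' => ?_) h0
  rw [Real.dist_eq, abs_le]
  have h1 := FF_lip q hq hn X w' w
  have h2 := FF_lip q hq hn X w w'
  simp only [fun i => sub_sq_comm (w i) (w' i)] at h2
  constructor <;> linarith

theorem gaussianVec_eq (n : ℕ) (σ : ℝ) :
    gaussianVec n σ = Measure.pi (fun _ => gaussianReal 0 (NNReal.mk (σ ^ 2) (sq_nonneg σ))) := rfl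

instance (n : ℕ) (σ : ℝ) : IsProbabilityMeasure (gaussianVec n σ) := by
  rw [gaussianVec_eq]; infer_instance

theorem FF_int (q : ℝ≥0∞) (hq : 1 ≤ q) {n L : ℕ} (hn : 1 ≤ n) (X : Fin n → Fin L → ℝ) (σ : ℝ) :
    Integrable (FF q X) (gaussianVec n σ) := by
  have hN : 0 ≤ Nq q X := ENNReal.toReal_nonneg
  have hi : Integrable (fun w : Fin n → ℝ => Nq q X / √n * ∑ i, |w i|) (gaussianVec n σ) := by
    refine Integrable.const_mul (integrable_finsetSum _ fun i _ => ?_) _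
    have h1 : Integrable (fun x : ℝ => |x|) (gaussianReal 0 (NNReal.mk (σ ^ 2) (sq_nonneg σ))) :=
      ((memLp_id_gaussianReal 1).integrable le_rfl).abs
    exact (measurePreserving_eval (fun _ : Fin n => gaussianReal 0 (NNReal.mk (σ ^ 2) (sq_nonneg σ))) i).integrable_comp_of_integrable h1
  refine hi.mono' (FF_cont q hq hn X).aestronglyMeasurable (Filter.Eventually.of_forall fun w => ?_)
  rw [Real.norm_of_nonneg (show 0 ≤ FF q X w from ENNReal.toReal_nonneg)]
  refine (FF_le q hn X w).trans ?_
  gcongr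
  rw [Real.sqrt_le_left (Finset.sum_nonneg fun i _ => abs_nonneg _)]
  simp only [← sq_abs (w _)]
  exact Finset.sum_sq_le_sq_sum_of_nonneg fun i _ => abs_nonneg _

theorem FF_scale (q : ℝ≥0∞) (hq : 1 ≤ q) {n L : ℕ} (hn : 1 ≤ n) (X : Fin n → Fin L → ℝ) (σ : ℝ) (hσ : 0 < σ) :
    ∫ w, FF q X w ∂(gaussianVec n σ) = σ * ∫ w, FF q X w ∂(gaussianVec n 1) := by
  have : gaussianVec n σ = (gaussianVec n 1).map (fun w i => σ * w i) := by
    rw [gaussianVec_eq, gaussianVec_eq]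
    have : ∀ _ : Fin n, IsProbabilityMeasure ((gaussianReal 0 (NNReal.mk (1 ^ 2) (sq_nonneg (1:ℝ)))).map (fun x => σ * x)) :=
      fun _ => Measure.isProbabilityMeasure_map (by fun_prop)
    rw [Measure.pi_map_pi (f := fun _ x => σ * x) (fun i => by fun_prop)]
    congr 1
    ext1 i
    rw [gaussianReal_map_const_mul]
    congr 1
    · simp
    · ext; simp
  rw [this, integral_map (by apply Measurable.aemeasurable; fun_prop) (FF_cont q hq hn X).aestronglyMeasurable, ← integral_const_mul]
  simp only [FF_smul q X σ hσ.le]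

theorem PLG_vec {s : ℝ} (hs0 : 0 < s) (hs1 : s < 1) (n : ℕ) {σ : ℝ} (hσ : 0 < σ) :
    PLG s (gaussianVec n σ) (fun x y => ∑ i, (x i - y i) ^ 2 / (2 * σ ^ 2)) :=
  (PLG.gauss hs0 hs1 (v := (NNReal.mk (σ ^ 2) (sq_nonneg σ))) (by
    intro h; have := congrArg NNReal.toReal h; simp [hσ.ne'] at this)).pi n

/-- Combined deviation bound, eq. (9). -/
theorem combined_deviation_bound
    (n L R : ℕ) (hn : 1 ≤ n) (hL : 1 ≤ L) (hR : 1 ≤ R) (X : Fin n → Fin L → ℝ)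
    (σ : ℝ) (hσ : 0 < σ) (q : ℝ≥0∞) (hq : 1 ≤ q)
    (t₁ t₂ : ℝ) (ht₁ : 0 ≤ t₁) (ht₂ : 0 ≤ t₂) :
    (((gaussianVec n σ).prod (Measure.pi (fun _ : Fin R => gaussianVec n 1)))
        {wz : (Fin n → ℝ) × (Fin R → Fin n → ℝ) |
          lqNorm q (fun j => (1 / (n : ℝ)) * ∑ i, X i j * wz.1 i)
            ≥ (σ / R) * ∑ r, lqNorm q (fun j => (1 / (n : ℝ)) * ∑ i, X i j * wz.2 r i)
              + t₁ + t₂}).toReal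
      ≤ Real.exp (-(n * t₁ ^ 2) / (2 * σ ^ 2 * (Nq q X) ^ 2))
        + Real.exp (-(n * R * t₂ ^ 2) / (2 * σ ^ 2 * (Nq q X) ^ 2)) := by
  have hN : 0 ≤ Nq q X := ENNReal.toReal_nonneg
  have hn' : (0:ℝ) < n := by exact_mod_cast hn
  have hR' : (0:ℝ) < R := by exact_mod_cast hR
  rcases hN.eq_or_lt with hN0 | hN0
  · rw [← hN0]
    simp only [ne_eq, OfNat.ofNat_ne_zero, not_false_eq_true, zero_pow, mul_zero, div_zero,
      Real.exp_zero]
    have : ∀ S, (((gaussianVec n σ).prod (Measure.pi (fun _ : Fin R => gaussianVec n 1))) S).toReal ≤ 1 :=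
      fun S => measureReal_le_one
    exact (this _).trans (by norm_num)
  set K := Nq q X / √n with hK
  have hK0 : 0 < K := by positivity
  have hK2 : K ^ 2 = Nq q X ^ 2 / n := by rw [hK, div_pow, Real.sq_sqrt hn'.le]
  set V := σ ^ 2 * K ^ 2 * (1 + 1 / R) with hV
  have hV0 : 0 < V := by positivity
  have hFm : Measurable (FF q X) := (FF_cont q hq hn X).measurable
  set μ := (gaussianVec n σ).prod (Measure.pi (fun _ : Fin R => gaussianVec n 1)) with hμ
  let G : (Fin n → ℝ) × (Fin R → Fin n → ℝ) → ℝ :=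
    fun wz => FF q X wz.1 - (σ / R) * ∑ r, FF q X (wz.2 r)
  have hGm : Measurable G := by
    refine (hFm.comp measurable_fst).sub (Measurable.const_mul ?_ _)
    exact Finset.measurable_sum _ fun r _ => hFm.comp (by fun_prop)
  have hi1 : Integrable (fun wz : (Fin n → ℝ) × (Fin R → Fin n → ℝ) => FF q X wz.1) μ :=
    (FF_int q hq hn X σ).comp_fst _
  have hi2r : ∀ r, Integrable (fun z : Fin R → Fin n → ℝ => FF q X (z r))
      (Measure.pi (fun _ : Fin R => gaussianVec n 1)) := fun r =>
    (measurePreserving_eval (fun _ : Fin R => gaussianVec n 1) r).integrable_comp_of_integrable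
      (FF_int q hq hn X 1)
  have hi2' : Integrable (fun z : Fin R → Fin n → ℝ => (σ / R) * ∑ r, FF q X (z r))
      (Measure.pi (fun _ : Fin R => gaussianVec n 1)) :=
    (integrable_finsetSum _ fun r _ => hi2r r).const_mul _
  have hi2 : Integrable (fun wz : (Fin n → ℝ) × (Fin R → Fin n → ℝ) =>
      (σ / R) * ∑ r, FF q X (wz.2 r)) μ := hi2'.comp_snd _
  have hGi : Integrable G μ := hi1.sub hi2
  have hG0 : ∫ x, G x ∂μ = 0 := by
    rw [integral_sub hi1 hi2, hμ, integral_fun_fst (fun w => FF q X w),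
      integral_fun_snd (fun z : Fin R → Fin n → ℝ => (σ / R) * ∑ r, FF q X (z r)),
      integral_const_mul, integral_finsetSum _ (fun r _ => hi2r r)]
    have : ∀ r : Fin R, ∫ z : Fin R → Fin n → ℝ, FF q X (z r)
        ∂(Measure.pi (fun _ : Fin R => gaussianVec n 1)) = ∫ w, FF q X w ∂(gaussianVec n 1) :=
      fun r => integral_comp_eval (μ := fun _ : Fin R => gaussianVec n 1)
        (FF_cont q hq hn X).aestronglyMeasurable
    simp only [this, FF_scale q hq hn X σ hσ]
    simp
    field_simp
    simp
  have hc := conc (μ := μ) (G := G) (V := V) (t := t₁ + t₂)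
    (fun s hs0 hs1 => (PLG_vec hs0 hs1 n hσ).prod ((PLG_vec hs0 hs1 n one_pos).pi R))
    hGm hGi hG0 hV0 ?_ (by positivity)
  · have hset : {wz : (Fin n → ℝ) × (Fin R → Fin n → ℝ) |
          lqNorm q (fun j => (1 / (n : ℝ)) * ∑ i, X i j * wz.1 i)
            ≥ (σ / R) * ∑ r, lqNorm q (fun j => (1 / (n : ℝ)) * ∑ i, X i j * wz.2 r i)
              + t₁ + t₂} = {x | t₁ + t₂ ≤ G x} := by
      ext x
      change (σ / R) * ∑ r, FF q X (x.2 r) + t₁ + t₂ ≤ FF q X x.1 ↔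
        t₁ + t₂ ≤ FF q X x.1 - (σ / R) * ∑ r, FF q X (x.2 r)
      constructor <;> intro h <;> linarith
    rw [hset]
    refine hc.trans ?_
    have e : -(t₁ + t₂) ^ 2 / (2 * V) =
        -(n * (R * (t₁ + t₂) ^ 2 / (R + 1))) / (2 * σ ^ 2 * (Nq q X) ^ 2) := by
      rw [hV, hK2]; field_simp
    rw [e]
    rcases le_total (t₁ ^ 2) (R * t₂ ^ 2) with h | h
    · refine le_trans (Real.exp_le_exp.2 ?_) (le_add_of_nonneg_right (Real.exp_pos _).le)
      gcongr
      rw [le_div_iff₀ (by positivity)]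
      nlinarith [mul_nonneg hR'.le (mul_nonneg ht₁ ht₂)]
    · refine le_trans (Real.exp_le_exp.2 ?_) (le_add_of_nonneg_left (Real.exp_pos _).le)
      rw [mul_assoc (n:ℝ)]
      gcongr
      rw [le_div_iff₀ (by positivity), mul_assoc]
      gcongr
      nlinarith [mul_nonneg ht₁ ht₂]
  · intro θ hθ x y
    have h1 := FF_lip q hq hn X x.1 y.1
    have h2 : ∀ r, FF q X (y.2 r) - FF q X (x.2 r) ≤ K * √(∑ i, (x.2 r i - y.2 r i) ^ 2) := by
      intro r
      have := FF_lip q hq hn X (y.2 r) (x.2 r)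
      simpa only [fun i => sub_sq_comm (y.2 r i) (x.2 r i)] using this
    rw [← hK] at h1
    simp only [← Finset.sum_div]
    have q1 := Real.sq_sqrt (Finset.sum_nonneg fun i _ => sq_nonneg (x.1 i - y.1 i) :
      0 ≤ ∑ i, (x.1 i - y.1 i) ^ 2)
    have q2 : ∀ r, √(∑ i, (x.2 r i - y.2 r i) ^ 2) ^ 2 = ∑ i, (x.2 r i - y.2 r i) ^ 2 := fun r =>
      Real.sq_sqrt (Finset.sum_nonneg fun i _ => sq_nonneg _)
    obtain ⟨D', hD'⟩ : ∃ D' : Fin R → ℝ, ∀ r, √(∑ i, (x.2 r i - y.2 r i) ^ 2) = D' r :=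
      ⟨_, fun r => rfl⟩
    simp only [hD'] at h2 q2
    generalize √(∑ i, (x.1 i - y.1 i) ^ 2) = D at h1 q1
    simp only [← q1, ← q2]
    have a1 : θ * (FF q X x.1 - FF q X y.1) ≤ θ ^ 2 * (σ ^ 2 * K ^ 2) / 2 + D ^ 2 / (2 * σ ^ 2) := by
      refine (mul_le_mul_of_nonneg_left h1 hθ).trans ?_
      have : θ ^ 2 * (σ ^ 2 * K ^ 2) / 2 + D ^ 2 / (2 * σ ^ 2) - θ * (K * D) =
        (θ * σ * K - D / σ) ^ 2 / 2 := by field_simp; ring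
      nlinarith [sq_nonneg (θ * σ * K - D / σ)]
    have a2 : ∀ r, θ * (σ / R) * (FF q X (y.2 r) - FF q X (x.2 r)) ≤
        θ ^ 2 * (σ ^ 2 * K ^ 2) / (2 * R ^ 2) + D' r ^ 2 / (2 * 1 ^ 2) := by
      intro r
      refine (mul_le_mul_of_nonneg_left (h2 r) (by positivity)).trans ?_
      have : θ ^ 2 * (σ ^ 2 * K ^ 2) / (2 * R ^ 2) + D' r ^ 2 / (2 * 1 ^ 2) - θ * (σ / R) * (K * D' r) =
        (θ * σ * K / R - D' r) ^ 2 / 2 := by field_simp; ring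
      nlinarith [sq_nonneg (θ * σ * K / R - D' r)]
    have a3 := Finset.sum_le_sum fun r (_ : r ∈ Finset.univ) => a2 r
    rw [← Finset.mul_sum, Finset.sum_sub_distrib, Finset.sum_add_distrib, Finset.sum_const,
      Finset.card_univ, Fintype.card_fin, nsmul_eq_mul] at a3
    have e1 : (R:ℝ) * (θ ^ 2 * (σ ^ 2 * K ^ 2) / (2 * R ^ 2)) = θ ^ 2 * (σ ^ 2 * K ^ 2) / (2 * R) := by
      field_simp
    have e2 : θ ^ 2 * V / 2 = θ ^ 2 * (σ ^ 2 * K ^ 2) / 2 + θ ^ 2 * (σ ^ 2 * K ^ 2) / (2 * R) := by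
      rw [hV]; field_simp
    rw [e1, ← Finset.sum_div] at a3
    rw [e2]
    simp only [G]
    linarith
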